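/- arXiv:2512.03732 — 4 statements merged into one kernel-verified Lean document; each statement's English description precedes it below -/
import Mathlib

section
/- Let V > 0, δ ∈ (0,1], α ∈ (0,1), β ∈ (−1,1], p_n > 0, p_r > 0, and define the consumer utilities U_n(θ) = θ(1+β−αβ)δV − p_n and U_r(θ) = θαδV − p_r for θ ∈ [0,1]. Then the Lebesgue measure of the set { θ ∈ [0,1] : U_r(θ) > U_n(θ) and U_r(θ) ≥ 0 } equals max{ 0, min{ 1, (p_n − p_r) / ((1+β)(1−α)δV) } − min{ 1, p_r / (αδV) } }. -/
/-- The Lebesgue measure of the part of `[0,1]` cut out by a lower threshold `b ≥ 0` and a strict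
upper threshold `a`. -/
theorem volume_unitInterval_between_thresholds {a b : ℝ} (hb : 0 ≤ b) :
    MeasureTheory.volume {θ : ℝ | θ ∈ Set.Icc (0 : ℝ) 1 ∧ θ < a ∧ b ≤ θ}
      = ENNReal.ofReal (max 0 (min 1 a - min 1 b)) := by
  have hvol : ENNReal.ofReal (max 0 (min 1 a - min 1 b)) = ENNReal.ofReal (min 1 a - b) := by
    rcases le_total b 1 with h | h
    · rw [min_eq_right h, ENNReal.ofReal_max, ENNReal.ofReal_zero, max_eq_right zero_le]
    · have h1 : min 1 a ≤ 1 := min_le_left _ _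
      rw [min_eq_left h, max_eq_left (by linarith), ENNReal.ofReal_zero,
        ENNReal.ofReal_of_nonpos (by linarith)]
  rw [hvol]
  apply le_antisymm
  · rw [← Real.volume_Icc]
    apply MeasureTheory.measure_mono
    rintro θ ⟨⟨-, h1⟩, ha, hbθ⟩
    exact ⟨hbθ, le_min h1 ha.le⟩
  · rw [← Real.volume_Ico]
    apply MeasureTheory.measure_mono
    rintro θ ⟨hbθ, h⟩
    obtain ⟨h1, ha⟩ := lt_min_iff.mp h
    exact ⟨⟨hb.trans hbθ, h1.le⟩, ha, hbθ⟩

/-- Probability that a uniformly random consumer `θ ∈ [0,1]` buys the remanufactured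
product: the Lebesgue measure of `{θ ∈ [0,1] : U_r(θ) > U_n(θ) and U_r(θ) ≥ 0}` equals
`max{0, min{1, (p_n − p_r)/((1+β)(1−α)δV)} − min{1, p_r/(αδV)}}`. -/
theorem reman_product_purchase_probability (V δ α β pn pr : ℝ)
    (hV : 0 < V) (hδ0 : 0 < δ) (hδ1 : δ ≤ 1) (hα0 : 0 < α) (hα1 : α < 1)
    (hβl : -1 < β) (hβu : β ≤ 1) (hpn : 0 < pn) (hpr : 0 < pr) :
    MeasureTheory.volume {θ : ℝ | θ ∈ Set.Icc (0 : ℝ) 1 ∧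
        θ * (1 + β - α * β) * δ * V - pn < θ * α * δ * V - pr ∧
        0 ≤ θ * α * δ * V - pr}
      = ENNReal.ofReal (max 0 (min 1 ((pn - pr) / ((1 + β) * (1 - α) * δ * V))
          - min 1 (pr / (α * δ * V)))) := by
  have hD : 0 < (1 + β) * (1 - α) * δ * V :=
    mul_pos (mul_pos (mul_pos (by linarith) (by linarith)) hδ0) hV
  have hE : 0 < α * δ * V := by positivity
  rw [← volume_unitInterval_between_thresholds (div_pos hpr hE).le]
  congr 1
  ext θ
  simp only [Set.mem_ofPred_eq, lt_div_iff₀ hD, div_le_iff₀ hE]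
  refine and_congr_right fun _ => and_congr ?_ ?_ <;>
    constructor <;> intro h <;> linarith
end

section
/- Let λ > 0, V > 0, δ ∈ (0,1], α ∈ (0,1), β ∈ (−1,1], c > 0, γ := c_r + c_coll > 0, and set K := (1+β)(1−α)δV and W := αδV. Define the approximate Model O profit Π̃^O(p_n, p_r) := λ(p_n − c)(1 − (p_n − p_r)/K) + λ(p_r − γ)((p_n − p_r)/K − p_r/W) on ℝ². Then Π̃^O is a strictly concave quadratic function (its Hessian is negative definite), it attains its unique global maximum at p_n* = (c + (1+β−αβ)δV)/2 and p_r* = (γ + αδV)/2, and the maximum value equals (λ/4)·[ (K − (c − γ))² / K + (W − γ)² / W ] = (λ/(4δV))·[ ((1+β)(1−α)δV − (c − c_r − c_coll))² / ((1+β)(1−α)) + (αδV − c_r − c_coll)² / α ]. -/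
/-- Strict positivity of a weighted sum of squares in the coordinates `p.1 - p.2` and `p.2`. -/
lemma sq_div_add_sq_div_pos {K W : ℝ} (hK : 0 < K) (hW : 0 < W) {p q : ℝ × ℝ} (h : p ≠ q) :
    0 < ((p.1 - p.2) - (q.1 - q.2)) ^ 2 / K + (p.2 - q.2) ^ 2 / W := by
  by_cases h2 : p.2 = q.2
  · have h1 : (p.1 - p.2) - (q.1 - q.2) ≠ 0 := fun h1 => h (Prod.ext (by linarith) h2)
    positivity
  · have h3 : p.2 - q.2 ≠ 0 := sub_ne_zero.mpr h2
    positivity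

/-- A constant minus a positive definite quadratic form centred at `q` is strictly concave. -/
lemma strictConcaveOn_sub_sq_div {K W lam : ℝ} (hK : 0 < K) (hW : 0 < W) (hlam : 0 < lam)
    (M : ℝ) (q : ℝ × ℝ) :
    StrictConcaveOn ℝ Set.univ fun p : ℝ × ℝ =>
      M - lam * (((p.1 - p.2) - (q.1 - q.2)) ^ 2 / K + (p.2 - q.2) ^ 2 / W) := by
  refine ⟨convex_univ, fun x _ y _ hxy a b ha hb hab => ?_⟩
  have hpos := mul_pos (mul_pos (mul_pos ha hb) hlam) (sq_div_add_sq_div_pos hK hW hxy)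
  obtain rfl : b = 1 - a := by linarith
  simp only [Prod.fst_add, Prod.snd_add, Prod.smul_fst, Prod.smul_snd, smul_eq_mul]
  rw [← sub_pos]
  convert hpos using 1
  ring

/-- The approximate Model O coexistence profit
`Π̃^O(p_n, p_r) = λ(p_n − c)(1 − (p_n − p_r)/K) + λ(p_r − γ)((p_n − p_r)/K − p_r/W)`,
with `K = (1+β)(1−α)δV` and `W = αδV`, is strictly concave, attains its unique global
maximum at `p_n* = (c + (1+β−αβ)δV)/2`, `p_r* = (γ + αδV)/2`, and the maximum value is
`(λ/4)[(K − (c − γ))²/K + (W − γ)²/W]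
  = (λ/(4δV))[((1+β)(1−α)δV − (c − c_r − c_coll))²/((1+β)(1−α)) + (αδV − c_r − c_coll)²/α]`. -/
theorem approx_model_O_optimum (lam V δ α β c cr ccoll : ℝ)
    (hlam : 0 < lam) (hV : 0 < V) (hδ0 : 0 < δ) (hδ1 : δ ≤ 1)
    (hα0 : 0 < α) (hα1 : α < 1) (hβl : -1 < β) (hβu : β ≤ 1)
    (hc : 0 < c) (hγ : 0 < cr + ccoll)
    (γ K W : ℝ) (hγdef : γ = cr + ccoll)
    (hK : K = (1 + β) * (1 - α) * δ * V) (hW : W = α * δ * V)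
    (f : ℝ × ℝ → ℝ)
    (hf : ∀ p : ℝ × ℝ, f p = lam * (p.1 - c) * (1 - (p.1 - p.2) / K)
        + lam * (p.2 - γ) * ((p.1 - p.2) / K - p.2 / W))
    (pstar : ℝ × ℝ)
    (hpstar : pstar = ((c + (1 + β - α * β) * δ * V) / 2, (γ + α * δ * V) / 2)) :
    StrictConcaveOn ℝ Set.univ f ∧
    (∀ p : ℝ × ℝ, f p ≤ f pstar) ∧
    (∀ p : ℝ × ℝ, f p = f pstar → p = pstar) ∧
    f pstar = lam / 4 * ((K - (c - γ)) ^ 2 / K + (W - γ) ^ 2 / W) ∧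
    lam / 4 * ((K - (c - γ)) ^ 2 / K + (W - γ) ^ 2 / W)
      = lam / (4 * (δ * V)) *
          (((1 + β) * (1 - α) * δ * V - (c - cr - ccoll)) ^ 2 / ((1 + β) * (1 - α))
            + (α * δ * V - cr - ccoll) ^ 2 / α) := by
  have hα : 0 < 1 - α := by linarith
  have hβ : 0 < 1 + β := by linarith
  have hK0 : 0 < K := by rw [hK]; positivity
  have hW0 : 0 < W := by rw [hW]; positivity
  have hp1 : pstar.1 = (c + K + W) / 2 := by rw [hpstar, hK, hW]; ring
  have hp2 : pstar.2 = (γ + W) / 2 := by rw [hpstar, hW]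
  have hmax : f pstar = lam / 4 * ((K - (c - γ)) ^ 2 / K + (W - γ) ^ 2 / W) := by
    rw [hf, hp1, hp2]
    field_simp
    ring
  have hsq : ∀ p, f p = f pstar - lam * (((p.1 - p.2) - (pstar.1 - pstar.2)) ^ 2 / K
      + (p.2 - pstar.2) ^ 2 / W) := by
    intro p
    rw [hmax, hf, hp1, hp2]
    field_simp
    ring
  refine ⟨?_, fun p => ?_, fun p hp => ?_, hmax, ?_⟩
  · rw [funext hsq]
    exact strictConcaveOn_sub_sq_div hK0 hW0 hlam _ _
  · rw [hsq p]
    exact sub_le_self _ (by positivity)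
  · by_contra hne
    have := mul_pos hlam (sq_div_add_sq_div_pos hK0 hW0 hne)
    linarith [hsq p]
  · subst hγdef hK hW
    field_simp
    ring
end

section
/- Let λ > 0, V > 0, δ ∈ (0,1], α ∈ (0,1), β ∈ (−1,1], c > 0, γ := c_r + c_coll > 0, K := (1+β)(1−α)δV, W := αδV, and let p_n* = (c + (1+β−αβ)δV)/2 and p_r* = (γ + W)/2 be the unconstrained maximizers of the approximate Model O profit. Then the remanufactured-product demand rate at the optimum, Λ_r* = λ((p_n* − p_r*)/K − p_r*/W), is strictly positive if and only if c − γ > (K/W)·γ = ((1+β)(1−α)/α)·(c_r + c_coll); and the new-product demand rate at the optimum, Λ_n* = λ(1 − (p_n* − p_r*)/K), is strictly positive if and only if c − γ < K = (1+β)(1−α)δV. -/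
/-- Sign conditions for the demand rates of Model O at the unconstrained optimal prices
`p_n* = (c + (1+β−αβ)δV)/2`, `p_r* = (γ + αδV)/2`, with `K = (1+β)(1−α)δV`, `W = αδV`:
the remanufactured-product rate `Λ_r* = λ((p_n* − p_r*)/K − p_r*/W)` is positive iff
`c − γ > (K/W)γ = ((1+β)(1−α)/α)(c_r + c_coll)`, and the new-product rate
`Λ_n* = λ(1 − (p_n* − p_r*)/K)` is positive iff `c − γ < K = (1+β)(1−α)δV`. -/
theorem model_O_demand_sign_conditions (lam V δ α β c cr ccoll : ℝ)
    (hlam : 0 < lam) (hV : 0 < V) (hδ0 : 0 < δ) (hδ1 : δ ≤ 1)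
    (hα0 : 0 < α) (hα1 : α < 1) (hβl : -1 < β) (hβu : β ≤ 1)
    (hc : 0 < c) (hγ : 0 < cr + ccoll)
    (γ K W pn pr : ℝ) (hγdef : γ = cr + ccoll)
    (hK : K = (1 + β) * (1 - α) * δ * V) (hW : W = α * δ * V)
    (hpn : pn = (c + (1 + β - α * β) * δ * V) / 2) (hpr : pr = (γ + W) / 2) :
    (0 < lam * ((pn - pr) / K - pr / W) ↔ c - γ > K / W * γ) ∧
    K / W * γ = (1 + β) * (1 - α) / α * (cr + ccoll) ∧
    (0 < lam * (1 - (pn - pr) / K) ↔ c - γ < K) ∧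
    K = (1 + β) * (1 - α) * δ * V := by
  have hKpos : 0 < K := by
    rw [hK]
    exact mul_pos (mul_pos (mul_pos (by linarith) (by linarith)) hδ0) hV
  have hWpos : 0 < W := by rw [hW]; positivity
  have hdiff : pn - pr = (c - γ + K) / 2 := by rw [hpn, hpr, hW, hK]; ring
  have hr : lam * ((pn - pr) / K - pr / W) = lam / (2 * K) * (c - γ - K / W * γ) := by
    rw [hdiff, hpr]
    field_simp
    ring
  have hn : lam * (1 - (pn - pr) / K) = lam / (2 * K) * (K - (c - γ)) := by
    rw [hdiff]
    field_simp
    ring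
  have hcoef : 0 < lam / (2 * K) := by positivity
  refine ⟨?_, ?_, ?_, hK⟩
  · rw [hr, mul_pos_iff_of_pos_left hcoef, sub_pos, gt_iff_lt]
  · rw [hK, hW, hγdef]
    field_simp
  · rw [hn, mul_pos_iff_of_pos_left hcoef, sub_pos]
end

section
/- Let V > 0, δ ∈ (0,1], α ∈ (0,1), c > 0, γ := c_r + c_coll > 0, W := αδV, and suppose D := ((αδV + γ)² − α(δV + c)²) · ((αδV − γ)² − α(δV − c)²) ≥ 0. Define β* := (αc² − γ² − α(1−α)(δV)² + √D) / (2α(1−α)(δV)²) and K* := (1+β*)(1−α)δV, and assume K* > 0. Then (1/4)·[ (K* − (c − γ))² / K* + (W − γ)² / W ] = (δV − c)² / (4δV); that is, the approximate coexistence-market optimal profit of Model O at perception factor β* equals the approximate optimal profit of Model N (for any common market-size factor λ > 0, λ/4·[(K* − (c−γ))²/K* + (W−γ)²/W] = λ(δV − c)²/(4δV)). -/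
/-- At the perception factor
`β* = (αc² − γ² − α(1−α)(δV)² + √D)/(2α(1−α)(δV)²)` with discriminant
`D = ((αδV + γ)² − α(δV + c)²)((αδV − γ)² − α(δV − c)²) ≥ 0` and `K* = (1+β*)(1−α)δV > 0`,
the approximate coexistence-market optimal profit of Model O equals the approximate
optimal profit of Model N: for any market-size factor `λ > 0`,
`(λ/4)[(K* − (c − γ))²/K* + (W − γ)²/W] = λ(δV − c)²/(4δV)` where `W = αδV`. -/
theorem approx_boundary_beta_star (V δ α c cr ccoll : ℝ)
    (hV : 0 < V) (hδ0 : 0 < δ) (hδ1 : δ ≤ 1) (hα0 : 0 < α) (hα1 : α < 1)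
    (hc : 0 < c) (hγ : 0 < cr + ccoll)
    (γ W D βs Ks : ℝ) (hγdef : γ = cr + ccoll) (hW : W = α * δ * V)
    (hD : D = ((α * δ * V + γ) ^ 2 - α * (δ * V + c) ^ 2)
        * ((α * δ * V - γ) ^ 2 - α * (δ * V - c) ^ 2))
    (hDnonneg : 0 ≤ D)
    (hβs : βs = (α * c ^ 2 - γ ^ 2 - α * (1 - α) * (δ * V) ^ 2 + Real.sqrt D)
        / (2 * α * (1 - α) * (δ * V) ^ 2))
    (hKs : Ks = (1 + βs) * (1 - α) * δ * V) (hKpos : 0 < Ks) :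
    ∀ lam : ℝ, 0 < lam →
      lam / 4 * ((Ks - (c - γ)) ^ 2 / Ks + (W - γ) ^ 2 / W)
        = lam * (δ * V - c) ^ 2 / (4 * (δ * V)) := by
  intro lam _
  have hm : 0 < δ * V := mul_pos hδ0 hV
  rw [mul_assoc] at hW hD
  rw [mul_assoc ((1 + βs) * (1 - α))] at hKs
  generalize δ * V = m at *
  have h1α : 0 < 1 - α := sub_pos.2 hα1
  have hsq : Real.sqrt D ^ 2 = D := Real.sq_sqrt hDnonneg
  have hroot : 2 * α * m * Ks
      = α * (1 - α) * m ^ 2 + α * c ^ 2 - γ ^ 2 + Real.sqrt D := by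
    rw [hKs, hβs]
    field_simp
    ring
  have hsqrt : Real.sqrt D
      = 2 * α * m * Ks - (α * (1 - α) * m ^ 2 + α * c ^ 2 - γ ^ 2) := by
    linarith
  rw [hsqrt, hD] at hsq
  have hquad : α * m * Ks ^ 2 + α * m * (c - γ) ^ 2
      = (α * (1 - α) * m ^ 2 + α * c ^ 2 - γ ^ 2) * Ks := by
    have h : 4 * α * m ≠ 0 := by positivity
    apply mul_left_cancel₀ h
    linear_combination hsq
  have hKne : Ks ≠ 0 := hKpos.ne'
  clear hKs hβs hsq hroot hsqrt
  subst hW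
  field_simp
  linear_combination hquad
end
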